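/- arXiv:1312.5991 — 11 statements merged into one kernel-verified Lean document; each statement's English description precedes it below -/
import Mathlib

section
/- Let k be a field, P and V two k-vector spaces, and ◁ : V × P → V, ▷ : P × V → V, θ : P × P → V three k-bilinear maps. Then the multiplication on P × V defined by (p, x) ⋆ (q, y) := (0, θ(p,q) + p ▷ y + x ◁ q) is associative if and only if for all p, q, r ∈ P and x ∈ V: p ▷ (x ◁ q) = (p ▷ x) ◁ q, (x ◁ p) ◁ q = 0, p ▷ (q ▷ x) = 0, and p ▷ θ(q, r) = θ(p, q) ◁ r. -/
/-- The multiplication of the would-be metabelian product `P ⋆ V`: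
`(p, x) ⋆ (q, y) = (0, θ(p,q) + p ▷ y + x ◁ q)`. -/
def metabStar {k : Type*} [Field k] {P V : Type*}
    [AddCommGroup P] [Module k P] [AddCommGroup V] [Module k V]
    (tl : V →ₗ[k] P →ₗ[k] V) (tr : P →ₗ[k] V →ₗ[k] V) (θ : P →ₗ[k] P →ₗ[k] V)
    (a b : P × V) : P × V :=
  ((0 : P), θ a.1 b.1 + tr a.1 b.2 + tl a.2 b.1)

/-- The multiplication `(p, x) ⋆ (q, y) = (0, θ(p,q) + p ▷ y + x ◁ q)` on `P × V` is
associative if and only if `(P, V, ◁, ▷, θ)` is a metabelian datum, i.e.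
`p ▷ (x ◁ q) = (p ▷ x) ◁ q`, `(x ◁ p) ◁ q = 0`, `p ▷ (q ▷ x) = 0` and
`p ▷ θ(q,r) = θ(p,q) ◁ r` for all `p q r ∈ P`, `x ∈ V`. -/
theorem metabStar_associative_iff_metabelianDatum
    {k : Type*} [Field k] {P V : Type*}
    [AddCommGroup P] [Module k P] [AddCommGroup V] [Module k V]
    (tl : V →ₗ[k] P →ₗ[k] V) (tr : P →ₗ[k] V →ₗ[k] V) (θ : P →ₗ[k] P →ₗ[k] V) :
    (∀ a b c : P × V,
        metabStar tl tr θ (metabStar tl tr θ a b) c =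
          metabStar tl tr θ a (metabStar tl tr θ b c)) ↔
      ((∀ (p q : P) (x : V), tr p (tl x q) = tl (tr p x) q) ∧
       (∀ (p q : P) (x : V), tl (tl x p) q = 0) ∧
       (∀ (p q : P) (x : V), tr p (tr q x) = 0) ∧
       (∀ p q r : P, tr p (θ q r) = tl (θ p q) r)) := by
  refine ⟨fun h => ⟨fun p q x => ?_, fun p q x => ?_, fun p q x => ?_, fun p q r => ?_⟩, ?_⟩
  · simpa [metabStar] using (h (p, 0) (0, x) (q, 0)).symm
  · simpa [metabStar] using h (0, x) (p, 0) (q, 0)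
  · simpa [metabStar] using (h (p, 0) (q, 0) (0, x)).symm
  · simpa [metabStar] using (h (p, 0) (q, 0) (r, 0)).symm
  · rintro ⟨h₁, h₂, h₃, h₄⟩ a b c
    simp [metabStar, h₁, h₂, h₃, h₄]
end

section
/- Let k be a field, A a (possibly non-unital) associative k-algebra, P an abelian k-algebra, π : A → P a surjective algebra homomorphism whose kernel V := ker π satisfies x·y = 0 for all x, y ∈ V, and s : P → A a k-linear map with π ∘ s = id_P. Define x ◁ p := x·s(p), p ▷ x := s(p)·x, and θ(p, q) := s(p)·s(q) for p, q ∈ P, x ∈ V (these values lie in V). Then (P, V, ◁, ▷, θ) is a metabelian datum, and the map φ : P ⋆ V → A, φ(p, x) := s(p) + x, is a bijective algebra homomorphism with inverse y ↦ (π(y), y − s(π(y))); moreover φ(0, x) = x for all x ∈ V and π(φ(p, x)) = p for all (p, x). -/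
/-- Let `A` be a non-unital associative `k`-algebra, `P` an abelian algebra,
`π : A → P` a surjective algebra homomorphism (into the abelian algebra `P₀`, so
`π (a*b) = 0`) whose kernel `V := ker π` has trivial multiplication, and `s : P → A` a
linear section of `π`.  With `x ◁ p := x * s p`, `p ▷ x := s p * x` and
`θ (p, q) := s p * s q` (all with values in `V`), the system `(P, V, ◁, ▷, θ)` is a
metabelian datum and `φ : P ⋆ V → A`, `φ (p, x) = s p + x`, is a bijective algebra
homomorphism with inverse `y ↦ (π y, y - s (π y))`; moreover `φ (0, x) = x` and
`π (φ (p, x)) = p`. -/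
theorem section_gives_metabelian_datum_and_iso
    {k : Type*} [Field k] {A P : Type*} [NonUnitalRing A] [Module k A]
    [SMulCommClass k A A] [IsScalarTower k A A] [AddCommGroup P] [Module k P]
    (π : A →ₗ[k] P) (hsurj : Function.Surjective π)
    (hπmul : ∀ a b : A, π (a * b) = 0)
    (hker : ∀ x y : A, π x = 0 → π y = 0 → x * y = 0)
    (s : P →ₗ[k] A) (hs : ∀ p : P, π (s p) = p) :
    -- `◁`, `▷` and `θ` take values in `V = ker π`
    (∀ (p : P) (x : A), π x = 0 → π (x * s p) = 0) ∧
    (∀ (p : P) (x : A), π x = 0 → π (s p * x) = 0) ∧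
    (∀ p q : P, π (s p * s q) = 0) ∧
    -- `(P, V, ◁, ▷, θ)` is a metabelian datum
    (∀ (p q : P) (x : A), π x = 0 → s p * (x * s q) = (s p * x) * s q) ∧
    (∀ (p q : P) (x : A), π x = 0 → (x * s p) * s q = 0) ∧
    (∀ (p q : P) (x : A), π x = 0 → s p * (s q * x) = 0) ∧
    (∀ p q r : P, s p * (s q * s r) = (s p * s q) * s r) ∧
    -- `φ (p, x) = s p + x` is a bijective algebra homomorphism `P ⋆ V → A`
    (Function.Bijective (fun z : P × (LinearMap.ker π) => s z.1 + (z.2 : A))) ∧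
    -- multiplicativity: `φ ((p,x) ⋆ (q,y)) = φ (p,x) * φ (q,y)`, where
    -- `(p,x) ⋆ (q,y) = (0, θ(p,q) + p ▷ y + x ◁ q)` and `φ (0, v) = v`
    (∀ z w : P × (LinearMap.ker π),
        (s z.1 + (z.2 : A)) * (s w.1 + (w.2 : A)) =
          s z.1 * s w.1 + s z.1 * (w.2 : A) + (z.2 : A) * s w.1) ∧
    -- the inverse of `φ` is `y ↦ (π y, y - s (π y))`
    (∀ y : A, ∃ z : P × (LinearMap.ker π),
        s z.1 + (z.2 : A) = y ∧ z.1 = π y ∧ (z.2 : A) = y - s (π y)) ∧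
    -- `φ` stabilizes `V` and co-stabilizes `P`
    (∀ x : LinearMap.ker π, s (0 : P) + (x : A) = (x : A)) ∧
    (∀ z : P × (LinearMap.ker π), π (s z.1 + (z.2 : A)) = z.1) := by
  have hinv (y : A) : ∃ z : P × (LinearMap.ker π),
      s z.1 + (z.2 : A) = y ∧ z.1 = π y ∧ (z.2 : A) = y - s (π y) :=
    ⟨(π y, ⟨y - s (π y), by simp [hs]⟩), by simp, rfl, rfl⟩
  have hproj (z : P × (LinearMap.ker π)) : π (s z.1 + (z.2 : A)) = z.1 := by
    rw [map_add, hs, LinearMap.mem_ker.mp z.2.2, add_zero]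
  refine ⟨fun _ _ _ => hπmul _ _, fun _ _ _ => hπmul _ _, fun _ _ => hπmul _ _,
    fun _ _ _ _ => (mul_assoc _ _ _).symm, fun p q x hx => ?_, fun p q x hx => ?_,
    fun _ _ _ => (mul_assoc _ _ _).symm, ⟨fun z w h => ?_, fun y => ?_⟩, fun z w => ?_,
    hinv, fun x => by simp, hproj⟩
  · rw [mul_assoc]
    exact hker _ _ hx (hπmul _ _)
  · rw [← mul_assoc]
    exact hker _ _ (hπmul _ _) hx
  · have h : s z.1 + (z.2 : A) = s w.1 + (w.2 : A) := h
    have h₁ : z.1 = w.1 := by rw [← hproj z, h, hproj w]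
    rw [h₁] at h
    exact Prod.ext h₁ (Subtype.ext (add_left_cancel h))
  · obtain ⟨z, hz, -⟩ := hinv y
    exact ⟨z, hz⟩
  · rw [add_mul, mul_add, mul_add, hker z.2 w.2 z.2.2 w.2.2, add_zero]
end

section
/- (Itô's theorem for associative algebras.) Let k be a field and A a (possibly non-unital) associative k-algebra such that A = P + V as vector spaces, where P and V are two abelian subalgebras of A (i.e. p·p' = 0 for all p, p' ∈ P and v·v' = 0 for all v, v' ∈ V). Then A is metabelian; in particular a₁·a₂·a₃·a₄ = 0 for all a₁, a₂, a₃, a₄ ∈ A. -/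
/-- If `A = S + T` with `S * S = 0` and `T * T = 0`, then any fourfold product with first factor in
`S` and last factor in `T` vanishes: split the product of the two middle factors along `S + T`. -/
lemma mul_mul_mul_eq_zero_of_mem_of_mem {A : Type*} [NonUnitalRing A] {S T : Set A}
    (hS : ∀ s ∈ S, ∀ s' ∈ S, s * s' = 0) (hT : ∀ t ∈ T, ∀ t' ∈ T, t * t' = 0)
    (hST : ∀ a : A, ∃ s ∈ S, ∃ t ∈ T, s + t = a)
    {s t : A} (hs : s ∈ S) (ht : t ∈ T) (b c : A) :
    s * b * c * t = 0 := by
  obtain ⟨s', hs', t', ht', h⟩ := hST (b * c)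
  rw [mul_assoc s b c, ← h, mul_add, hS s hs s' hs', zero_add, mul_assoc, hT t' ht' t ht,
    mul_zero]

/-- If `A = S + T` with `S * S = 0` and `T * T = 0`, then any fourfold product with first and last
factors in `S` vanishes. -/
lemma mul_mul_mul_self_eq_zero_of_mem {A : Type*} [NonUnitalRing A] {S T : Set A}
    (hS : ∀ s ∈ S, ∀ s' ∈ S, s * s' = 0) (hT : ∀ t ∈ T, ∀ t' ∈ T, t * t' = 0)
    (hST : ∀ a : A, ∃ s ∈ S, ∃ t ∈ T, s + t = a)
    {s s' : A} (hs : s ∈ S) (hs' : s' ∈ S) (b c : A) :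
    s * b * c * s' = 0 := by
  obtain ⟨p, hp, v, hv, rfl⟩ := hST b
  obtain ⟨q, hq, w, hw, rfl⟩ := hST c
  rw [mul_add s, hS s hs p hp, zero_add, mul_add, mul_assoc s v w, hT v hv w hw, mul_zero,
    add_zero, mul_assoc, hS q hq s' hs', mul_zero]

/-- **Itô's theorem for associative algebras.**  If a non-unital associative `k`-algebra
`A` is the sum `A = P + V` of two abelian subalgebras `P` and `V`, then `A` is
metabelian: the product of any four elements of `A` is zero. -/
theorem ito_for_associative_algebras
    {k : Type*} [Field k] {A : Type*} [NonUnitalRing A] [Module k A]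
    [SMulCommClass k A A] [IsScalarTower k A A]
    (P V : Submodule k A)
    (hP : ∀ p ∈ P, ∀ p' ∈ P, p * p' = 0)
    (hV : ∀ v ∈ V, ∀ v' ∈ V, v * v' = 0)
    (hPV : P ⊔ V = ⊤) :
    ∀ a₁ a₂ a₃ a₄ : A, a₁ * a₂ * a₃ * a₄ = 0 := by
  have split (a : A) : ∃ p ∈ (P : Set A), ∃ v ∈ (V : Set A), p + v = a :=
    Submodule.mem_sup.mp (hPV ▸ Submodule.mem_top)
  have split' (a : A) : ∃ v ∈ (V : Set A), ∃ p ∈ (P : Set A), v + p = a := by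
    obtain ⟨p, hp, v, hv, h⟩ := split a
    exact ⟨v, hv, p, hp, by rw [add_comm, h]⟩
  intro a b c d
  obtain ⟨p, hp, v, hv, rfl⟩ := split a
  obtain ⟨p', hp', v', hv', rfl⟩ := split d
  simp only [add_mul, mul_add,
    mul_mul_mul_eq_zero_of_mem_of_mem hP hV split hp hv',
    mul_mul_mul_eq_zero_of_mem_of_mem hV hP split' hv hp',
    mul_mul_mul_self_eq_zero_of_mem hP hV split hp hp',
    mul_mul_mul_self_eq_zero_of_mem hV hP split' hv hv', add_zero]
end

section
/- Let k be a field, P a k-vector space, and θ, θ' : P × P → k two bilinear forms. Denote by P_θ the algebra on the vector space P × k with multiplication (p, x) ⋆ (q, y) := (0, θ(p, q)), and similarly P_{θ'}. Then P_θ and P_{θ'} are isomorphic as algebras if and only if θ and θ' are homothetic, i.e. there exist u ∈ k \ {0} and a linear automorphism ψ of P such that u·θ(p, q) = θ'(ψ(p), ψ(q)) for all p, q ∈ P. -/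
/-- A linear automorphism of `P × k` that scales the vector `(0, 1)` induces a linear automorphism
of `P`, identified with the quotient of `P × k` by the line `0 × k`. -/
theorem exists_linearEquiv_fst_of_apply_zero_one
    {k : Type*} [Field k] {P : Type*} [AddCommGroup P] [Module k P]
    (φ : (P × k) ≃ₗ[k] (P × k)) {u : k} (hu : u ≠ 0) (hφ : ∀ t : k, φ (0, t) = (0, u * t)) :
    ∃ ψ : P ≃ₗ[k] P, ∀ p : P, ψ p = (φ (p, 0)).1 := by
  let f : P →ₗ[k] P := LinearMap.fst k P k ∘ₗ φ.toLinearMap ∘ₗ LinearMap.inl k P k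
  have hf : ∀ p, f p = (φ (p, 0)).1 := fun _ => rfl
  refine ⟨LinearEquiv.ofBijective f ⟨?_, fun q => ?_⟩, hf⟩
  · refine (injective_iff_map_eq_zero f).2 fun p hp => ?_
    have h : φ (p, 0) = φ (0, u⁻¹ * (φ (p, 0)).2) := by
      rw [hφ, mul_inv_cancel_left₀ hu]
      exact Prod.ext hp rfl
    exact congrArg Prod.fst (φ.injective h)
  · obtain ⟨⟨p, x⟩, hpx⟩ := φ.surjective (q, 0)
    refine ⟨p, ?_⟩
    have h : φ (p, x) = φ (p, 0) + φ (0, x) := by simp [← map_add]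
    rw [hpx, hφ] at h
    simpa [hf] using (congrArg Prod.fst h).symm


/-- Let `θ, θ'` be bilinear forms on a `k`-vector space `P`, and let `P_θ` be the algebra
on `P × k` with multiplication `(p, x) ⋆ (q, y) = (0, θ (p, q))`.  Then `P_θ ≅ P_θ'` as
algebras if and only if `θ` and `θ'` are homothetic: there are `u ∈ k \ {0}` and
`ψ ∈ Aut_k(P)` with `u * θ (p, q) = θ' (ψ p, ψ q)` for all `p q`. -/
theorem Ptheta_iso_iff_homothetic
    {k : Type*} [Field k] {P : Type*} [AddCommGroup P] [Module k P]
    (θ θ' : P →ₗ[k] P →ₗ[k] k) :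
    (∃ φ : (P × k) ≃ₗ[k] (P × k), ∀ a b : P × k,
        φ ((0 : P), θ a.1 b.1) = (((0 : P), θ' (φ a).1 (φ b).1) : P × k)) ↔
      (∃ (u : k) (ψ : P ≃ₗ[k] P), u ≠ 0 ∧
        ∀ p q : P, u * θ p q = θ' (ψ p) (ψ q)) := by
  constructor
  · rintro ⟨φ, hφ⟩
    by_cases hθ : ∀ p q, θ p q = 0
    · refine ⟨1, LinearEquiv.refl k P, one_ne_zero, fun p q => ?_⟩
      have h := hφ (φ.symm (p, 0)) (φ.symm (q, 0))
      rw [hθ, Prod.mk_zero_zero, map_zero] at h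
      simpa [hθ] using congrArg Prod.snd h
    · push Not at hθ
      obtain ⟨p₀, q₀, h₀⟩ := hθ
      have hsmul : ∀ c t : k, φ (0, c * t) = c • φ (0, t) := fun c t => by simp [← map_smul]
      have hfst : (φ (0, 1)).1 = 0 := by
        have h := congrArg Prod.fst (hφ (p₀, 0) (q₀, 0))
        rw [← mul_one (θ _ _), hsmul] at h
        exact (smul_eq_zero.1 h).resolve_left h₀
      have hline : ∀ t : k, φ (0, t) = (0, (φ (0, 1)).2 * t) := fun t => by
        rw [← mul_one t, hsmul]
        ext <;> simp [hfst, mul_comm]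
      have hu : (φ (0, 1)).2 ≠ 0 := fun h => by
        have h1 : φ (0, 1) = 0 := Prod.ext hfst h
        simp at h1
      obtain ⟨ψ, hψ⟩ := exists_linearEquiv_fst_of_apply_zero_one φ hu hline
      refine ⟨_, ψ, hu, fun p q => ?_⟩
      have h := hφ (p, 0) (q, 0)
      rw [hline] at h
      rw [hψ, hψ]
      exact congrArg Prod.snd h
  · rintro ⟨u, ψ, hu, h⟩
    exact ⟨ψ.prodCongr (LinearEquiv.smulOfNeZero k k u hu), fun a b => by simp [← h]⟩
end

section
/- Let k be a field in which every element is a square (k = k²), P a k-vector space, and θ, θ' : P × P → k two bilinear forms. Then the algebras P_θ and P_{θ'} are isomorphic if and only if θ and θ' are isometric, i.e. there exists a linear automorphism ψ of P such that θ(p, q) = θ'(ψ(p), ψ(q)) for all p, q ∈ P. -/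
/-- If every element of the field `k` is a square (`k = k²`), then for bilinear forms
`θ, θ'` on a `k`-vector space `P` the algebras `P_θ` and `P_θ'` (on `P × k` with
multiplication `(p, x) ⋆ (q, y) = (0, θ (p, q))`) are isomorphic if and only if `θ` and
`θ'` are isometric: there is `ψ ∈ Aut_k(P)` with `θ (p, q) = θ' (ψ p, ψ q)` for all
`p q`. -/
theorem Ptheta_iso_iff_isometric_of_squares
    {k : Type*} [Field k] (hsq : ∀ x : k, ∃ y : k, x = y ^ 2)
    {P : Type*} [AddCommGroup P] [Module k P]
    (θ θ' : P →ₗ[k] P →ₗ[k] k) :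
    (∃ φ : (P × k) ≃ₗ[k] (P × k), ∀ a b : P × k,
        φ ((0 : P), θ a.1 b.1) = (((0 : P), θ' (φ a).1 (φ b).1) : P × k)) ↔
      (∃ ψ : P ≃ₗ[k] P, ∀ p q : P, θ p q = θ' (ψ p) (ψ q)) := by
  constructor
  · rintro ⟨φ, hφ⟩
    by_cases hθ : ∀ p q, θ p q = 0
    · refine ⟨LinearEquiv.refl k P, fun p q => ?_⟩
      have h := hφ (φ.symm (p, 0)) (φ.symm (q, 0))
      rw [hθ, Prod.mk_zero_zero, map_zero] at h
      simpa [hθ] using congrArg Prod.snd h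
    · push Not at hθ
      obtain ⟨p₀, q₀, h₀⟩ := hθ
      have hfst : (φ (0, 1)).1 = 0 := by
        have h := congrArg Prod.fst (hφ (p₀, 0) (q₀, 0))
        have hs : ((0 : P), θ p₀ q₀) = θ p₀ q₀ • ((0 : P), (1 : k)) := by simp
        rw [hs, map_smul, Prod.smul_fst] at h
        exact (smul_eq_zero.mp h).resolve_left h₀
      obtain ⟨d, hd⟩ := hsq (φ (0, 1)).2
      have hline (x : k) : φ (0, x) = (0, x * d ^ 2) := by
        have hs : ((0 : P), x) = x • ((0 : P), (1 : k)) := by simp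
        rw [hs, map_smul, Prod.ext_iff]
        simp [hfst, hd]
      have hd0 : d ≠ 0 := by
        rintro rfl
        have h : φ (0, 1) = 0 := (hline 1).trans (by simp)
        exact one_ne_zero (congrArg Prod.snd (φ.map_eq_zero_iff.mp h))
      let f : P →ₗ[k] P := LinearMap.fst k P k ∘ₗ φ.toLinearMap ∘ₗ LinearMap.inl k P k
      have hf (p : P) : f p = (φ (p, 0)).1 := rfl
      have hbij : Function.Bijective f := by
        constructor
        · refine (injective_iff_map_eq_zero f).mpr fun p hp => ?_
          have h : φ (p, 0) = φ (0, (φ (p, 0)).2 / d ^ 2) := by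
            rw [hline, div_mul_cancel₀ _ (pow_ne_zero 2 hd0)]
            exact Prod.ext hp rfl
          exact congrArg Prod.fst (φ.injective h)
        · intro q
          obtain ⟨⟨p, x⟩, h⟩ := φ.surjective (q, 0)
          have hs : (p, x) = (p, (0 : k)) + (0, x) := by simp
          rw [hs, map_add, hline] at h
          exact ⟨p, by simpa [hf] using congrArg Prod.fst h⟩
      refine ⟨(LinearEquiv.ofBijective f hbij).trans
        (LinearEquiv.smulOfNeZero k P d⁻¹ (inv_ne_zero hd0)), fun p q => ?_⟩
      have h := hφ (p, 0) (q, 0)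
      rw [hline] at h
      have h2 : θ p q * d ^ 2 = θ' (f p) (f q) := congrArg Prod.snd h
      simp only [LinearEquiv.trans_apply, LinearEquiv.ofBijective_apply,
        LinearEquiv.smulOfNeZero_apply, map_smul, LinearMap.smul_apply, smul_eq_mul, ← h2]
      field_simp
  · rintro ⟨ψ, hψ⟩
    exact ⟨ψ.prodCongr (LinearEquiv.refl k k), fun a b => by simp [hψ]⟩
end

section
/- Let k be a field, P a k-vector space, and θ : P × P → k a nonzero bilinear form. Let 𝒢(P, θ) be the set of triples (u, λ, ψ) ∈ (k \ {0}) × Hom_k(P, k) × Aut_k(P) with u·θ(p, q) = θ(ψ(p), ψ(q)) for all p, q ∈ P, with multiplication (u, λ, ψ)·(u', λ', ψ') := (uu', λ∘ψ' + uλ', ψ∘ψ'). Then 𝒢(P, θ) is a group under this multiplication, and the map sending (u, λ, ψ) to the algebra automorphism φ_{(u,λ,ψ)} of P_θ given by φ_{(u,λ,ψ)}(p, x) = (ψ(p), λ(p) + u·x) is a group isomorphism from 𝒢(P, θ) onto the automorphism group Aut_Alg(P_θ); in particular φ_{(u,λ,ψ)} ∘ φ_{(u',λ',ψ')} = φ_{(uu',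 λ∘ψ' + uλ', ψ∘ψ')}. -/
section

variable {k : Type*} [Field k] {P : Type*} [AddCommGroup P] [Module k P]

/-- The defining condition of `𝒢(P, θ)`: triples `(u, λ, ψ)` with `u ≠ 0` and
`u * θ (p, q) = θ (ψ p, ψ q)` for all `p q ∈ P`. -/
def gCond (θ : P →ₗ[k] P →ₗ[k] k) (t : k × (P →ₗ[k] k) × (P ≃ₗ[k] P)) : Prop :=
  t.1 ≠ 0 ∧ ∀ p q : P, t.1 * θ p q = θ (t.2.2 p) (t.2.2 q)

/-- The multiplication of `𝒢(P, θ)`: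
`(u, λ, ψ) · (u', λ', ψ') = (u u', λ ∘ ψ' + u λ', ψ ∘ ψ')`. -/
def gMul (t t' : k × (P →ₗ[k] k) × (P ≃ₗ[k] P)) : k × (P →ₗ[k] k) × (P ≃ₗ[k] P) :=
  (t.1 * t'.1, t.2.1 ∘ₗ (t'.2.2 : P →ₗ[k] P) + t.1 • t'.2.1, t'.2.2.trans t.2.2)

/-- The identity triple `(1, 0, id)`. -/
def gOne : k × (P →ₗ[k] k) × (P ≃ₗ[k] P) := (1, 0, LinearEquiv.refl k P)

/-- `φ` is an algebra automorphism of `P_θ`, the algebra on `P × k` with multiplication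
`(p, x) ⋆ (q, y) = (0, θ (p, q))`. -/
def isAlgAut (θ : P →ₗ[k] P →ₗ[k] k) (φ : (P × k) ≃ₗ[k] (P × k)) : Prop :=
  ∀ a b : P × k, φ ((0 : P), θ a.1 b.1) = (((0 : P), θ (φ a).1 (φ b).1) : P × k)

theorem gCond_gMul {θ : P →ₗ[k] P →ₗ[k] k} {t t' : k × (P →ₗ[k] k) × (P ≃ₗ[k] P)}
    (h : gCond θ t) (h' : gCond θ t') : gCond θ (gMul t t') := by
  refine ⟨mul_ne_zero h.1 h'.1, fun p q => ?_⟩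
  simp only [gMul, LinearEquiv.trans_apply]
  rw [← h.2, ← h'.2, mul_assoc]

theorem gCond_gOne (θ : P →ₗ[k] P →ₗ[k] k) : gCond θ (gOne (k := k) (P := P)) :=
  ⟨one_ne_zero, fun p q => by simp [gOne]⟩

theorem gMul_assoc (t t' t'' : k × (P →ₗ[k] k) × (P ≃ₗ[k] P)) :
    gMul (gMul t t') t'' = gMul t (gMul t' t'') := by
  refine Prod.ext (mul_assoc _ _ _) (Prod.ext ?_ rfl)
  ext p
  simp only [gMul, LinearMap.add_apply, LinearMap.comp_apply, LinearMap.smul_apply,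
    LinearEquiv.coe_coe, LinearEquiv.trans_apply, smul_eq_mul]
  ring

theorem gMul_gOne (t : k × (P →ₗ[k] k) × (P ≃ₗ[k] P)) : gMul t gOne = t := by
  refine Prod.ext (mul_one _) (Prod.ext ?_ rfl)
  ext p
  simp [gMul, gOne]

theorem gOne_gMul (t : k × (P →ₗ[k] k) × (P ≃ₗ[k] P)) : gMul gOne t = t := by
  refine Prod.ext (one_mul _) (Prod.ext ?_ rfl)
  ext p
  simp [gMul, gOne]

/-- The inverse triple `(u⁻¹, -u⁻¹ (λ ∘ ψ⁻¹), ψ⁻¹)`. -/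
def gInv (t : k × (P →ₗ[k] k) × (P ≃ₗ[k] P)) : k × (P →ₗ[k] k) × (P ≃ₗ[k] P) :=
  (t.1⁻¹, -(t.1⁻¹ • (t.2.1 ∘ₗ (t.2.2.symm : P →ₗ[k] P))), t.2.2.symm)

theorem gCond_gInv {θ : P →ₗ[k] P →ₗ[k] k} {t : k × (P →ₗ[k] k) × (P ≃ₗ[k] P)}
    (h : gCond θ t) : gCond θ (gInv t) := by
  refine ⟨inv_ne_zero h.1, fun p q => ?_⟩
  have := h.2 (t.2.2.symm p) (t.2.2.symm q)
  simp only [LinearEquiv.apply_symm_apply] at this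
  simp only [gInv]
  rw [← this, inv_mul_cancel_left₀ h.1]

theorem gMul_gInv {t : k × (P →ₗ[k] k) × (P ≃ₗ[k] P)} (h : t.1 ≠ 0) :
    gMul t (gInv t) = gOne := by
  refine Prod.ext (mul_inv_cancel₀ h) (Prod.ext ?_ ?_)
  · ext p
    simp [gMul, gInv, gOne, h]
  · ext p
    simp [gMul, gInv, gOne]

theorem gInv_gMul {t : k × (P →ₗ[k] k) × (P ≃ₗ[k] P)} (h : t.1 ≠ 0) :
    gMul (gInv t) t = gOne := by
  refine Prod.ext (inv_mul_cancel₀ h) (Prod.ext ?_ ?_)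
  · ext p
    simp [gMul, gInv, gOne]
  · ext p
    simp [gMul, gInv, gOne]

/-- The linear map `φ_{(u,λ,ψ)} (p, x) = (ψ p, λ p + u x)`. -/
def gMap (t : k × (P →ₗ[k] k) × (P ≃ₗ[k] P)) : (P × k) →ₗ[k] (P × k) :=
  ((t.2.2 : P →ₗ[k] P) ∘ₗ LinearMap.fst k P k).prod
    (t.2.1 ∘ₗ LinearMap.fst k P k + t.1 • LinearMap.snd k P k)

theorem gMap_apply (t : k × (P →ₗ[k] k) × (P ≃ₗ[k] P)) (a : P × k) :
    gMap t a = (t.2.2 a.1, t.2.1 a.1 + t.1 * a.2) := rfl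

theorem gMap_gMul (t t' : k × (P →ₗ[k] k) × (P ≃ₗ[k] P)) :
    gMap (gMul t t') = gMap t ∘ₗ gMap t' := by
  refine LinearMap.ext fun a => Prod.ext rfl ?_
  simp only [gMap_apply, gMul, LinearMap.add_apply, LinearMap.comp_apply, LinearMap.smul_apply,
    LinearEquiv.coe_coe, smul_eq_mul]
  ring

theorem gMap_gOne : gMap (gOne (k := k) (P := P)) = LinearMap.id := by
  refine LinearMap.ext fun a => ?_
  simp [gMap_apply, gOne]

theorem gMap_injective : Function.Injective (gMap (k := k) (P := P)) := by
  intro t t' h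
  have hp (p : P) : (t.2.2 p, t.2.1 p) = (t'.2.2 p, t'.2.1 p) := by
    simpa [gMap_apply] using LinearMap.congr_fun h (p, 0)
  have hu : t.1 = t'.1 := by
    simpa [gMap_apply] using LinearMap.congr_fun h (0, 1)
  exact Prod.ext hu (Prod.ext (LinearMap.ext fun p => congrArg Prod.snd (hp p))
    (LinearEquiv.ext fun p => congrArg Prod.fst (hp p)))

/-- The linear automorphism `φ_{(u,λ,ψ)}` for `u ≠ 0`. -/
def gEquiv (t : k × (P →ₗ[k] k) × (P ≃ₗ[k] P)) (h : t.1 ≠ 0) : (P × k) ≃ₗ[k] (P × k) :=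
  LinearEquiv.ofLinearMap (gMap t) (gMap (gInv t))
    (by rw [← gMap_gMul, gMul_gInv h, gMap_gOne])
    (by rw [← gMap_gMul, gInv_gMul h, gMap_gOne])

theorem isAlgAut_gEquiv {θ : P →ₗ[k] P →ₗ[k] k} {t : k × (P →ₗ[k] k) × (P ≃ₗ[k] P)}
    (h : gCond θ t) : isAlgAut θ (gEquiv t h.1) := by
  intro a b
  simp [gEquiv, gMap_apply, h.2]

theorem isAlgAut.symm {θ : P →ₗ[k] P →ₗ[k] k} {φ : (P × k) ≃ₗ[k] (P × k)}
    (h : isAlgAut θ φ) : isAlgAut θ φ.symm := by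
  intro a b
  rw [LinearEquiv.symm_apply_eq, h]
  simp

theorem isAlgAut.fst_apply_zero {θ : P →ₗ[k] P →ₗ[k] k} (hθ : θ ≠ 0)
    {φ : (P × k) ≃ₗ[k] (P × k)} (h : isAlgAut θ φ) (x : k) : (φ (0, x)).1 = 0 := by
  obtain ⟨p, q, hpq⟩ : ∃ p q, θ p q ≠ 0 := by
    by_contra! H
    exact hθ (LinearMap.ext₂ H)
  have hx : ((0, x) : P × k) = (x / θ p q) • (0, θ p q) := by
    simp [hpq]
  rw [hx, map_smul, h (p, 0) (q, 0)]
  simp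

theorem isAlgAut.fst_apply {θ : P →ₗ[k] P →ₗ[k] k} (hθ : θ ≠ 0)
    {φ : (P × k) ≃ₗ[k] (P × k)} (h : isAlgAut θ φ) (a : P × k) :
    (φ (a.1, 0)).1 = (φ a).1 := by
  have ha : a = (a.1, 0) + (0, a.2) := by simp
  conv_rhs => rw [ha, map_add, Prod.fst_add, h.fst_apply_zero hθ, add_zero]

/-- The automorphism of `P` induced by an algebra automorphism of `P_θ`. -/
def isAlgAut.fstEquiv {θ : P →ₗ[k] P →ₗ[k] k} (hθ : θ ≠ 0)
    {φ : (P × k) ≃ₗ[k] (P × k)} (h : isAlgAut θ φ) : P ≃ₗ[k] P :=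
  LinearEquiv.ofLinearMap
    (LinearMap.fst k P k ∘ₗ (φ : (P × k) →ₗ[k] (P × k)) ∘ₗ LinearMap.inl k P k)
    (LinearMap.fst k P k ∘ₗ (φ.symm : (P × k) →ₗ[k] (P × k)) ∘ₗ LinearMap.inl k P k)
    (LinearMap.ext fun p => by simp [h.fst_apply hθ])
    (LinearMap.ext fun p => by simp [h.symm.fst_apply hθ])

theorem isAlgAut.exists_gEquiv_eq {θ : P →ₗ[k] P →ₗ[k] k} (hθ : θ ≠ 0)
    {φ : (P × k) ≃ₗ[k] (P × k)} (h : isAlgAut θ φ) :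
    ∃ (t : k × (P →ₗ[k] k) × (P ≃ₗ[k] P)) (ht : gCond θ t), gEquiv t ht.1 = φ := by
  have hsmul (x : k) : φ (0, x) = (0, (φ (0, 1)).2 * x) := by
    have hx : ((0, x) : P × k) = x • (0, 1) := by simp
    rw [hx, map_smul]
    ext
    · simp [h.fst_apply_zero hθ]
    · simp [mul_comm]
  have hu : (φ (0, 1)).2 ≠ 0 := by
    intro hu
    have h0 : φ (0, 1) = 0 := Prod.ext (h.fst_apply_zero hθ 1) hu
    simp at h0
  have hcond : gCond θ ((φ (0, 1)).2,
      LinearMap.snd k P k ∘ₗ (φ : (P × k) →ₗ[k] (P × k)) ∘ₗ LinearMap.inl k P k,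
      h.fstEquiv hθ) := by
    refine ⟨hu, fun p q => ?_⟩
    have hpq := h (p, 0) (q, 0)
    rw [hsmul] at hpq
    exact congrArg Prod.snd hpq
  refine ⟨_, hcond, LinearEquiv.ext fun a => ?_⟩
  have ha : φ a = φ (a.1, 0) + (0, (φ (0, 1)).2 * a.2) := by simp [← hsmul, ← map_add]
  refine Eq.trans ?_ ha.symm
  exact Prod.ext (add_zero _).symm rfl

/-- For a nonzero bilinear form `θ` on `P`, the set `𝒢(P, θ)` of triples `(u, λ, ψ)`
with `u * θ (p, q) = θ (ψ p, ψ q)` is a group under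
`(u, λ, ψ) · (u', λ', ψ') = (u u', λ ∘ ψ' + u λ', ψ ∘ ψ')`, and
`(u, λ, ψ) ↦ φ_{(u,λ,ψ)}`, `φ_{(u,λ,ψ)} (p, x) = (ψ p, λ p + u x)`, is a group
isomorphism `𝒢(P, θ) ≅ Aut_Alg(P_θ)`; in particular
`φ_{(u,λ,ψ)} ∘ φ_{(u',λ',ψ')} = φ_{(u,λ,ψ)·(u',λ',ψ')}`. -/
theorem gGroup_iso_autAlg (θ : P →ₗ[k] P →ₗ[k] k) (hθ : θ ≠ 0) :
    -- `𝒢(P, θ)` is closed under the multiplication, contains the identity,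
    -- the multiplication is associative, and every element has an inverse
    (∀ t t', gCond θ t → gCond θ t' → gCond θ (gMul t t')) ∧
    gCond θ (gOne (k := k) (P := P)) ∧
    (∀ t t' t'' : k × (P →ₗ[k] k) × (P ≃ₗ[k] P),
        gMul (gMul t t') t'' = gMul t (gMul t' t'')) ∧
    (∀ t : k × (P →ₗ[k] k) × (P ≃ₗ[k] P), gMul t gOne = t ∧ gMul gOne t = t) ∧
    (∀ t, gCond θ t → ∃ t', gCond θ t' ∧ gMul t t' = gOne ∧ gMul t' t = gOne) ∧
    -- the map `(u, λ, ψ) ↦ φ_{(u,λ,ψ)}` is a group isomorphism onto `Aut_Alg(P_θ)`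
    (∃ F : {t : k × (P →ₗ[k] k) × (P ≃ₗ[k] P) // gCond θ t} →
           {φ : (P × k) ≃ₗ[k] (P × k) // isAlgAut θ φ},
        Function.Bijective F ∧
        (∀ t (p : P) (x : k),
            (F t : (P × k) ≃ₗ[k] (P × k)) (p, x) =
              (t.1.2.2 p, t.1.2.1 p + t.1.1 * x)) ∧
        (∀ (t t' : {t : k × (P →ₗ[k] k) × (P ≃ₗ[k] P) // gCond θ t}) (p : P) (x : k),
            (F t : (P × k) ≃ₗ[k] (P × k))
                ((F t' : (P × k) ≃ₗ[k] (P × k)) (p, x)) =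
              ((gMul t.1 t'.1).2.2 p,
               (gMul t.1 t'.1).2.1 p + (gMul t.1 t'.1).1 * x))) := by
  refine ⟨fun _ _ => gCond_gMul, gCond_gOne θ, gMul_assoc,
    fun t => ⟨gMul_gOne t, gOne_gMul t⟩,
    fun t ht => ⟨gInv t, gCond_gInv ht, gMul_gInv ht.1, gInv_gMul ht.1⟩,
    fun t => ⟨gEquiv t.1 t.2.1, isAlgAut_gEquiv t.2⟩, ⟨?_, ?_⟩, fun _ _ _ => rfl, ?_⟩
  · intro t t' h
    exact Subtype.ext (gMap_injective
      (congrArg (fun φ => (φ.1 : (P × k) →ₗ[k] (P × k))) h))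
  · rintro ⟨φ, h⟩
    obtain ⟨t, ht, rfl⟩ := h.exists_gEquiv_eq hθ
    exact ⟨⟨t, ht⟩, rfl⟩
  · intro t t' p x
    exact (LinearMap.congr_fun (gMap_gMul t.1 t'.1) (p, x)).symm

end
end

section
/- Let k be a field and V a k-vector space. For linear endomorphisms λ, Λ of V, define bilinear maps ◁ : V × k → V and ▷ : k × V → V by x ◁ p := p·λ(x) and p ▷ x := p·Λ(x). Then (k, ◁, ▷) is a discrete bimodule over V (i.e. (x ◁ p) ◁ q = 0, p ▷ (q ▷ x) = 0 and p ▷ (x ◁ q) = (p ▷ x) ◁ q for all p, q ∈ k, x ∈ V) if and only if λ² = 0, Λ² = 0 and Λ ∘ λ = λ ∘ Λ. Moreover, every discrete bimodule structure of k over V arises from a unique such pair (λ, Λ) in this way. -/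
/-- For endomorphisms `λ, Λ` of a `k`-vector space `V`, the bilinear maps
`x ◁ p := p • λ x` and `p ▷ x := p • Λ x` make `k` a discrete bimodule over `V` if and
only if `λ² = Λ² = 0` and `Λ ∘ λ = λ ∘ Λ`; moreover every discrete bimodule structure of
`k` over `V` arises from a unique pair `(λ, Λ)` in this way. -/
theorem discrete_bimodule_structures_on_k
    {k : Type*} [Field k] {V : Type*} [AddCommGroup V] [Module k V]
    (lam Lam : V →ₗ[k] V) :
    -- `(k, ◁, ▷)` with `x ◁ p = p • λ x`, `p ▷ x = p • Λ x` is a discrete bimodule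
    -- over `V` iff `λ² = Λ² = 0` and `Λ ∘ λ = λ ∘ Λ`
    (((∀ (p q : k) (x : V), p • lam (q • lam x) = 0) ∧
      (∀ (p q : k) (x : V), p • Lam (q • Lam x) = 0) ∧
      (∀ (p q : k) (x : V), p • Lam (q • lam x) = q • lam (p • Lam x))) ↔
      (lam ∘ₗ lam = 0 ∧ Lam ∘ₗ Lam = 0 ∧ Lam ∘ₗ lam = lam ∘ₗ Lam)) ∧
    -- every discrete bimodule structure of `k` over `V` is of this form,
    -- for a unique pair of endomorphisms
    (∀ (tl : V →ₗ[k] k →ₗ[k] V) (tr : k →ₗ[k] V →ₗ[k] V),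
        (∀ (p q : k) (x : V), tl (tl x p) q = 0) →
        (∀ (p q : k) (x : V), tr p (tr q x) = 0) →
        (∀ (p q : k) (x : V), tr p (tl x q) = tl (tr p x) q) →
        ∃! lt : (V →ₗ[k] V) × (V →ₗ[k] V),
          ∀ (p : k) (x : V), tl x p = p • lt.1 x ∧ tr p x = p • lt.2 x) := by
  refine ⟨⟨fun ⟨h₁, h₂, h₃⟩ => ⟨?_, ?_, ?_⟩, fun ⟨h₁, h₂, h₃⟩ => ⟨?_, ?_, ?_⟩⟩, ?_⟩
  · ext x
    simpa using h₁ 1 1 x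
  · ext x
    simpa using h₂ 1 1 x
  · ext x
    simpa using h₃ 1 1 x
  · intro p q x
    have h : lam (lam x) = 0 := LinearMap.congr_fun h₁ x
    simp [h]
  · intro p q x
    have h : Lam (Lam x) = 0 := LinearMap.congr_fun h₂ x
    simp [h]
  · intro p q x
    have h : Lam (lam x) = lam (Lam x) := LinearMap.congr_fun h₃ x
    rw [map_smul, map_smul, h, smul_comm]
  · intro tl tr _ _ _
    refine ⟨(tl.flip 1, tr 1), fun p x => ⟨?_, ?_⟩, ?_⟩
    · rw [LinearMap.flip_apply, ← map_smul, smul_eq_mul, mul_one]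
    · rw [← LinearMap.smul_apply, ← map_smul, smul_eq_mul, mul_one]
    · rintro ⟨l, r⟩ h
      refine Prod.ext (LinearMap.ext fun x => ?_) (LinearMap.ext fun x => ?_)
      · simpa using (h 1 x).1.symm
      · simpa using (h 1 x).2.symm
end

section
/- Let k be a field, V a k-vector space, and λ, Λ ∈ End_k(V) with λ² = Λ² = 0 and Λ∘λ = λ∘Λ; equip k with the discrete bimodule structure over V given by x ◁ p := p·λ(x), p ▷ x := p·Λ(x). For ζ, ζ' ∈ Ker(Λ − λ), the discrete cocycles θ_ζ(p,q) = pq·ζ and θ_{ζ'}(p,q) = pq·ζ' are cohomologous (i.e. there exists a k-linear map r : k → V with θ_ζ(p, q) = θ_{ζ'}(p, q) + p ▷ r(q) + r(p) ◁ q for all p, q ∈ k) if and only if ζ − ζ' ∈ Im(Λ + λ). -/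
/-- Let `λ, Λ ∈ End_k(V)` with `λ² = Λ² = 0`, `Λ∘λ = λ∘Λ`, and equip `k` with the
discrete bimodule structure `x ◁ p := p • λ x`, `p ▷ x := p • Λ x` over `V`.  For
`ζ, ζ' ∈ Ker (Λ - λ)`, the cocycles `θ_ζ (p, q) = (p q) • ζ` and `θ_ζ' (p, q) = (p q) • ζ'`
are cohomologous (there is a linear `r : k → V` with
`θ_ζ (p, q) = θ_ζ' (p, q) + p ▷ r q + r p ◁ q`) iff `ζ - ζ' ∈ Im (Λ + λ)`. -/
theorem cocycles_cohomologous_iff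
    {k : Type*} [Field k] {V : Type*} [AddCommGroup V] [Module k V]
    (lam Lam : V →ₗ[k] V)
    (hl : lam ∘ₗ lam = 0) (hL : Lam ∘ₗ Lam = 0) (hc : Lam ∘ₗ lam = lam ∘ₗ Lam)
    (ζ ζ' : V) (hζ : Lam ζ = lam ζ) (hζ' : Lam ζ' = lam ζ') :
    (∃ r : k →ₗ[k] V, ∀ p q : k,
        (p * q) • ζ = (p * q) • ζ' + p • Lam (r q) + q • lam (r p)) ↔
      ζ - ζ' ∈ LinearMap.range (Lam + lam) := by
  constructor
  · rintro ⟨r, hr⟩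
    refine ⟨r 1, ?_⟩
    have h := hr 1 1
    simp only [mul_one, one_smul] at h
    rw [h, LinearMap.add_apply]
    abel
  · rintro ⟨v, hv⟩
    refine ⟨LinearMap.toSpanSingleton k V v, fun p q => ?_⟩
    rw [← sub_add_cancel ζ ζ', ← hv]
    simp only [LinearMap.add_apply, LinearMap.toSpanSingleton_apply, map_smul]
    module
end

section
/- Let k be a field, V a k-vector space, λ, Λ ∈ End_k(V) with λ² = Λ² = 0 and Λ∘λ = λ∘Λ, and ζ ∈ V with Λ(ζ) = λ(ζ). Then the multiplication on k × V defined by (p, x) ⋆ (q, y) := (0, pq·ζ + p·Λ(y) + q·λ(x)) is associative, and the resulting algebra k ⋆_{(λ,Λ,ζ)} V is metabelian: the product of any four of its elements is zero. -/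
/-- The multiplication of the metabelian product `k ⋆_{(λ,Λ,ζ)} V`:
`(p, x) ⋆ (q, y) = (0, (p q) • ζ + p • Λ y + q • λ x)`. -/
def kStar {k : Type*} [Field k] {V : Type*} [AddCommGroup V] [Module k V]
    (lam Lam : V →ₗ[k] V) (ζ : V) (a b : k × V) : k × V :=
  ((0 : k), (a.1 * b.1) • ζ + a.1 • Lam b.2 + b.1 • lam a.2)

/-- For `λ, Λ ∈ End_k(V)` with `λ² = Λ² = 0`, `Λ∘λ = λ∘Λ` and `ζ ∈ Ker (Λ - λ)`, the
multiplication `(p, x) ⋆ (q, y) = (0, (p q) • ζ + p • Λ y + q • λ x)` on `k × V` is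
associative, and the resulting algebra `k ⋆_{(λ,Λ,ζ)} V` is metabelian: any product of
four of its elements is zero. -/
theorem kStar_associative_and_metabelian
    {k : Type*} [Field k] {V : Type*} [AddCommGroup V] [Module k V]
    (lam Lam : V →ₗ[k] V)
    (hl : lam ∘ₗ lam = 0) (hL : Lam ∘ₗ Lam = 0) (hc : Lam ∘ₗ lam = lam ∘ₗ Lam)
    (ζ : V) (hζ : Lam ζ = lam ζ) :
    (∀ a b c : k × V,
        kStar lam Lam ζ (kStar lam Lam ζ a b) c =
          kStar lam Lam ζ a (kStar lam Lam ζ b c)) ∧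
    (∀ a b c d : k × V,
        kStar lam Lam ζ (kStar lam Lam ζ (kStar lam Lam ζ a b) c) d = 0) := by
  have hl' (x : V) : lam (lam x) = 0 := LinearMap.congr_fun hl x
  have hL' (x : V) : Lam (Lam x) = 0 := LinearMap.congr_fun hL x
  have hc' (x : V) : Lam (lam x) = lam (Lam x) := LinearMap.congr_fun hc x
  refine ⟨fun a b c => Prod.ext rfl ?_, fun a b c d => Prod.ext rfl ?_⟩
  · simp only [kStar, map_add, map_smul, hl', hL', hc', hζ, zero_mul, mul_zero, zero_smul,
      smul_zero, zero_add, add_zero]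
    module
  · simp [kStar, hl']
end

section
/- Let k be a field, n a positive integer, and θ, θ' ∈ M_n(k) two n × n matrices, viewed as bilinear forms on k^n. Then the algebras k^{n+1}_θ := (k^n)_θ and k^{n+1}_{θ'} := (k^n)_{θ'} are isomorphic as algebras if and only if there exist u ∈ k \ {0} and an invertible matrix C ∈ GL_n(k) such that u·θ = Cᵀ·θ'·C. -/
open Matrix

/-- Two matrices defining the same bilinear form are equal. -/
theorem Matrix.eq_of_dotProduct_mulVec_eq {k ι : Type*} [CommSemiring k] [Fintype ι]
    {A B : Matrix ι ι k} (h : ∀ v w : ι → k, v ⬝ᵥ A *ᵥ w = v ⬝ᵥ B *ᵥ w) : A = B := by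
  classical
  ext i j
  simpa using h (Pi.single i 1) (Pi.single j 1)

/-- The bilinear form of `Cᵀ * A * C` is the pullback along `C` of the bilinear form of `A`. -/
theorem Matrix.dotProduct_transpose_mul_mul_mulVec {k ι : Type*} [CommSemiring k] [Fintype ι]
    (A C : Matrix ι ι k) (v w : ι → k) :
    v ⬝ᵥ (Cᵀ * A * C) *ᵥ w = (C *ᵥ v) ⬝ᵥ A *ᵥ (C *ᵥ w) := by
  rw [← mulVec_mulVec, ← mulVec_mulVec, dotProduct_mulVec, vecMul_transpose]

/-- Let `θ, θ' ∈ M_n(k)` be matrices, viewed as bilinear forms `θ (v, w) = vᵀ θ w` on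
`kⁿ`.  The algebras `k^{n+1}_θ = (kⁿ)_θ` and `k^{n+1}_{θ'} = (kⁿ)_{θ'}` (on `kⁿ × k`
with multiplication `(v, x) ⋆ (w, y) = (0, vᵀ θ w)`) are isomorphic if and only if there
are `u ∈ k \ {0}` and an invertible matrix `C ∈ GL_n(k)` with `u • θ = Cᵀ * θ' * C`. -/
theorem matrix_Ptheta_iso_iff_homothetic
    {k : Type*} [Field k] {n : ℕ} (hn : 0 < n)
    (θ θ' : Matrix (Fin n) (Fin n) k) :
    (∃ φ : ((Fin n → k) × k) ≃ₗ[k] ((Fin n → k) × k),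
        ∀ a b : (Fin n → k) × k,
          φ ((0 : Fin n → k), a.1 ⬝ᵥ θ.mulVec b.1) =
            (((0 : Fin n → k), (φ a).1 ⬝ᵥ θ'.mulVec (φ b).1) : (Fin n → k) × k)) ↔
      (∃ (u : k) (C : Matrix (Fin n) (Fin n) k),
        u ≠ 0 ∧ IsUnit C ∧ u • θ = C.transpose * θ' * C) := by
  constructor
  · rintro ⟨φ, hφ⟩
    by_cases hθ : θ = 0
    · refine ⟨1, 1, one_ne_zero, isUnit_one, ?_⟩
      have hθ' : θ' = 0 := by
        refine Matrix.eq_of_dotProduct_mulVec_eq fun v w => ?_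
        have h := congrArg Prod.snd (hφ (φ.symm (v, 0)) (φ.symm (w, 0)))
        have h0 : φ ((0 : Fin n → k), (0 : k)) = 0 := map_zero φ
        simpa [hθ, h0] using h.symm
      simp [hθ, hθ']
    · obtain ⟨v₀, w₀, h₀⟩ : ∃ v w : Fin n → k, v ⬝ᵥ θ *ᵥ w ≠ 0 := by
        by_contra! h
        exact hθ (Matrix.eq_of_dotProduct_mulVec_eq fun v w => by simp [h v w])
      have hsmul (x : k) : φ ((0 : Fin n → k), x) = x • φ (0, 1) := by
        rw [← map_smul]
        simp
      have hfst : (φ ((0 : Fin n → k), (1 : k))).1 = 0 := by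
        have h := congrArg Prod.fst (hφ (v₀, 0) (w₀, 0))
        rw [hsmul] at h
        exact (smul_eq_zero.mp h).resolve_left h₀
      let f : (Fin n → k) →ₗ[k] (Fin n → k) :=
        LinearMap.fst k _ _ ∘ₗ φ.toLinearMap ∘ₗ LinearMap.inl k _ _
      have hf (a : (Fin n → k) × k) : (φ a).1 = f a.1 := by
        have ha : a = (a.1, 0) + (0, a.2) := by simp
        conv_lhs => rw [ha, map_add, hsmul]
        simp [f, hfst]
      refine ⟨(φ ((0 : Fin n → k), (1 : k))).2, LinearMap.toMatrix' f, ?_, ?_, ?_⟩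
      · intro hu
        have h : φ ((0 : Fin n → k), (1 : k)) = 0 := Prod.ext hfst hu
        simpa using φ.map_eq_zero_iff.mp h
      · refine Matrix.mulVec_surjective_iff_isUnit.mp fun v => ⟨(φ.symm (v, 0)).1, ?_⟩
        rw [LinearMap.toMatrix'_mulVec, ← hf, φ.apply_symm_apply]
      · refine Matrix.eq_of_dotProduct_mulVec_eq fun v w => ?_
        have h := congrArg Prod.snd (hφ (v, 0) (w, 0))
        rw [hsmul, hf, hf] at h
        rw [Matrix.dotProduct_transpose_mul_mul_mulVec, LinearMap.toMatrix'_mulVec,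
          LinearMap.toMatrix'_mulVec, smul_mulVec, dotProduct_smul, smul_eq_mul, mul_comm]
        exact h
  · rintro ⟨u, C, hu, hC, h⟩
    let e : (Fin n → k) ≃ₗ[k] (Fin n → k) :=
      LinearEquiv.ofBijective C.mulVecLin
        ⟨Matrix.mulVec_injective_iff_isUnit.mpr hC, Matrix.mulVec_surjective_iff_isUnit.mpr hC⟩
    refine ⟨e.prodCongr (LinearEquiv.smulOfNeZero k k u hu), fun a b => ?_⟩
    have hab := Matrix.dotProduct_transpose_mul_mul_mulVec θ' C a.1 b.1
    rw [← h, smul_mulVec, dotProduct_smul] at hab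
    exact Prod.ext (map_zero e) hab
end

section
/- Let k be a field, P and V two k-vector spaces, and let (P, V, ◁, ▷, θ) and (P, V, ◁', ▷', θ') be two metabelian data. Then the extensions (P ⋆_{(◁,▷,θ)} V, i_V, π_P) and (P ⋆_{(◁',▷',θ')} V, i_V, π_P) of P₀ by V₀ are equivalent — i.e. there exists an algebra homomorphism φ : P ⋆_{(◁,▷,θ)} V → P ⋆_{(◁',▷',θ')} V with φ(0, x) = (0, x) for all x ∈ V and π_P(φ(p, x)) = p for all (p, x) — if and only if ◁' = ◁, ▷' = ▷, and θ and θ' are cohomologous, i.e. there exists a linear map r : P → V with θ(p, q) = θ'(p, q) + p ▷ r(q) + r(p) ◁ q for all p, q ∈ P. -/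
/-- For two metabelian data `(P, V, ◁, ▷, θ)` and `(P, V, ◁', ▷', θ')`, the extensions
`(P ⋆_{(◁,▷,θ)} V, i_V, π_P)` and `(P ⋆_{(◁',▷',θ')} V, i_V, π_P)` of `P₀` by `V₀` are
equivalent (there is an algebra homomorphism `φ` between them stabilizing `V₀` and
co-stabilizing `P₀`) if and only if `◁' = ◁`, `▷' = ▷` and `θ, θ'` are cohomologous,
i.e. `θ (p, q) = θ' (p, q) + p ▷ r q + r p ◁ q` for some linear map `r : P → V`. -/
theorem extensions_equivalent_iff
    {k : Type*} [Field k] {P V : Type*}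
    [AddCommGroup P] [Module k P] [AddCommGroup V] [Module k V]
    (tl tl' : V →ₗ[k] P →ₗ[k] V) (tr tr' : P →ₗ[k] V →ₗ[k] V)
    (θ θ' : P →ₗ[k] P →ₗ[k] V)
    (h1 : ∀ (p q : P) (x : V), tr p (tl x q) = tl (tr p x) q)
    (h2 : ∀ (p q : P) (x : V), tl (tl x p) q = 0)
    (h3 : ∀ (p q : P) (x : V), tr p (tr q x) = 0)
    (h4 : ∀ p q r : P, tr p (θ q r) = tl (θ p q) r)
    (h1' : ∀ (p q : P) (x : V), tr' p (tl' x q) = tl' (tr' p x) q)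
    (h2' : ∀ (p q : P) (x : V), tl' (tl' x p) q = 0)
    (h3' : ∀ (p q : P) (x : V), tr' p (tr' q x) = 0)
    (h4' : ∀ p q r : P, tr' p (θ' q r) = tl' (θ' p q) r) :
    (∃ φ : P × V →ₗ[k] P × V,
        (∀ a b : P × V, φ (metabStar tl tr θ a b) = metabStar tl' tr' θ' (φ a) (φ b)) ∧
        (∀ x : V, φ ((0 : P), x) = ((0 : P), x)) ∧
        (∀ a : P × V, (φ a).1 = a.1)) ↔
      (tl' = tl ∧ tr' = tr ∧
        ∃ r : P →ₗ[k] V, ∀ p q : P, θ p q = θ' p q + tr p (r q) + tl (r p) q) := by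
  constructor
  · rintro ⟨φ, hmul, hV, hP⟩
    have hstar : ∀ a b : P × V, θ a.1 b.1 + tr a.1 b.2 + tl a.2 b.1 =
        θ' a.1 b.1 + tr' a.1 (φ b).2 + tl' (φ a).2 b.1 := by
      intro a b
      have h := congrArg Prod.snd (hmul a b)
      simpa only [metabStar, hV, hP] using h
    have htl : tl' = tl := by
      ext x q
      simpa [hV] using (hstar (0, x) (q, 0)).symm
    have htr : tr' = tr := by
      ext p y
      simpa [hV] using (hstar (p, 0) (0, y)).symm
    subst htl htr
    refine ⟨rfl, rfl, LinearMap.snd k P V ∘ₗ φ ∘ₗ LinearMap.inl k P V, fun p q => ?_⟩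
    simpa using hstar (p, 0) (q, 0)
  · rintro ⟨rfl, rfl, r, hr⟩
    refine ⟨(LinearMap.fst k P V).prod (r ∘ₗ LinearMap.fst k P V + LinearMap.snd k P V),
      fun a b => ?_, fun x => by simp, fun a => by simp⟩
    ext
    · simp [metabStar]
    · simp only [metabStar, LinearMap.prod_apply, Function.prod_apply, LinearMap.fst_apply,
        LinearMap.snd_apply, LinearMap.add_apply, LinearMap.comp_apply, map_add, map_zero, hr]
      abel
end
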